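/- arXiv:2411.19110 — 2 statements merged into one kernel-verified Lean document; each statement's English description precedes it below -/
import Mathlib

section
/- Let Ĝ be the spectral-extremal gem-free graph as above. Then the number of edges inside W = V(Ĝ) \ N[û] satisfies e(W) < e(N_+(û)) − |N_+(û)| + 2 − Σ_{u ∈ N_0(û)} x_u/x_û. -/
open scoped Classical
open SimpleGraph Matrix

def ContainsCopy {α β : Type*} (H : SimpleGraph α) (G : SimpleGraph β) : Prop :=
  ∃ f : α ↪ β, ∀ a b, H.Adj a b → G.Adj (f a) (f b)

def gem : SimpleGraph (Fin 5) :=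
  SimpleGraph.fromRel (fun a b => (b.val = a.val + 1 ∧ b.val ≤ 3) ∨ b = 4)

def bookS (k : ℕ) : SimpleGraph (Fin 2 ⊕ Fin k) :=
  SimpleGraph.fromRel (fun a _ => a.isLeft = true)

def pendantS (s t : ℕ) : SimpleGraph (Fin 2 ⊕ (Fin s ⊕ Fin t)) :=
  SimpleGraph.fromRel (fun a b =>
    match a, b with
    | Sum.inl _, Sum.inl _ => True
    | Sum.inl _, Sum.inr (Sum.inl _) => True
    | Sum.inl i, Sum.inr (Sum.inr _) => i = 0
    | _, _ => False)

def starG (r : ℕ) : SimpleGraph (Fin (r + 1)) :=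
  SimpleGraph.fromRel (fun a _ => a = 0)

noncomputable def specRad {V : Type*} [Fintype V] (G : SimpleGraph V) : ℝ :=
  sSup {μ : ℝ | Module.End.HasEigenvalue (Matrix.mulVecLin (G.adjMatrix ℝ)) μ}

noncomputable def edgeCount {V : Type*} [Fintype V] (G : SimpleGraph V) : ℕ :=
  G.edgeFinset.card

noncomputable def edgesIn {V : Type*} [Fintype V] (G : SimpleGraph V) (S : Finset V) : ℕ :=
  (G.edgeFinset.filter (fun e => ∀ v ∈ e, v ∈ S)).card

noncomputable def N0 {V : Type*} [Fintype V] (G : SimpleGraph V) (u : V) : Finset V :=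
  (G.neighborFinset u).filter (fun v => ∀ w ∈ G.neighborFinset u, ¬ G.Adj v w)

noncomputable def Nplus {V : Type*} [Fintype V] (G : SimpleGraph V) (u : V) : Finset V :=
  G.neighborFinset u \ N0 G u

noncomputable def Wset {V : Type*} [Fintype V] (G : SimpleGraph V) (u : V) : Finset V :=
  Finset.univ \ insert u (G.neighborFinset u)

def InFamily (m : ℕ) {V : Type*} [Fintype V] (G : SimpleGraph V) : Prop :=
  ¬ ContainsCopy gem G ∧ edgeCount G = m ∧ (∀ v : V, ∃ w, G.Adj v w) ∧
    ¬ Nonempty (G ≃g bookS ((m - 1) / 2))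

def MaxInFamily (m : ℕ) {V : Type*} [Fintype V] (G : SimpleGraph V) : Prop :=
  InFamily m G ∧ ∀ (n : ℕ) (H : SimpleGraph (Fin n)), InFamily m H → specRad H ≤ specRad G

def IsCutVertex {V : Type*} (G : SimpleGraph V) (v : V) : Prop :=
  ∃ a b : {x : V // x ≠ v}, G.Reachable a.1 b.1 ∧
    ¬ (G.induce {x : V | x ≠ v}).Reachable a b

section Counting

variable {V : Type*} [Fintype V] (G : SimpleGraph V)

lemma two_mul_edgesIn (S : Finset V) :
    2 * (edgesIn G S : ℝ) = ∑ v ∈ S, ∑ w ∈ S, if G.Adj v w then (1 : ℝ) else 0 := by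
  let H : SimpleGraph V :=
    { Adj := fun v w => G.Adj v w ∧ v ∈ S ∧ w ∈ S
      symm := ⟨fun v w h => ⟨h.1.symm, h.2.2, h.2.1⟩⟩
      loopless := ⟨fun v h => G.loopless.irrefl v h.1⟩ }
  have hcard : edgesIn G S = H.edgeFinset.card := by
    unfold edgesIn
    congr 1
    ext e
    induction e with
    | _ v w => simp [H]
  have hsum := H.sum_degrees_eq_twice_card_edges
  have hdeg : ∀ v, (H.degree v : ℝ) = ∑ w, if H.Adj v w then (1 : ℝ) else 0 := by
    intro v
    rw [← H.card_neighborFinset_eq_degree, H.neighborFinset_eq_filter, Finset.sum_boole]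
  rw [hcard]
  have hsum' : (∑ v, (H.degree v : ℝ)) = 2 * (H.edgeFinset.card : ℝ) := by exact_mod_cast hsum
  rw [← hsum', Finset.sum_congr rfl fun v _ => hdeg v, ← Finset.sum_subset S.subset_univ]
  · refine Finset.sum_congr rfl fun v hv => ?_
    rw [← Finset.sum_subset S.subset_univ]
    · exact Finset.sum_congr rfl fun w hw => by simp [H, hv, hw]
    · intro w _ hw
      simp [H, hw]
  · intro v _ hv
    simp [H, hv]

lemma two_mul_edgeCount :
    2 * (edgeCount G : ℝ) = ∑ v, ∑ w, if G.Adj v w then (1 : ℝ) else 0 := by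
  rw [← two_mul_edgesIn]
  simp [edgesIn, edgeCount]

lemma sum_eq_add_sum_neighborFinset_add_sum_Wset (u : V) (f : V → ℝ) :
    ∑ v, f v = f u + ∑ v ∈ G.neighborFinset u, f v + ∑ v ∈ Wset G u, f v := by
  rw [Wset, ← Finset.sum_insert (by simp), add_comm,
    Finset.sum_sdiff (Finset.subset_univ _)]

end Counting

section SpectralRadius

variable {V : Type*} [Fintype V] (G : SimpleGraph V)

lemma le_specRad {μ : ℝ} {x : V → ℝ} (hx : x ≠ 0)
    (h : ∀ v, ∑ w, (if G.Adj v w then x w else 0) = μ * x v) : μ ≤ specRad G := by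
  refine le_csSup (Module.End.finite_hasEigenvalue _).bddAbove ?_
  refine Module.End.hasEigenvalue_of_hasEigenvector (x := x)
    ⟨Module.End.mem_eigenspace_iff.2 ?_, hx⟩
  ext v
  simpa [Matrix.mulVec, dotProduct, adjMatrix_apply] using h v

end SpectralRadius

section Iso

variable {V V' : Type*} [Fintype V] [Fintype V'] {G : SimpleGraph V} {H : SimpleGraph V'}

lemma InFamily.of_iso (e : G ≃g H) {m : ℕ} (h : InFamily m G) : InFamily m H := by
  obtain ⟨hgem, hcard, hiso, hbook⟩ := h
  refine ⟨?_, ?_, ?_, ?_⟩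
  · rintro ⟨f, hf⟩
    exact hgem ⟨f.trans e.symm.toEquiv.toEmbedding,
      fun a b hab => e.symm.map_adj_iff.2 (hf a b hab)⟩
  · rw [← hcard]
    exact e.card_edgeFinset_eq.symm
  · intro v
    obtain ⟨w, hw⟩ := hiso (e.symm v)
    exact ⟨e w, by simpa using e.map_adj_iff.2 hw⟩
  · rintro ⟨f⟩
    exact hbook ⟨e.trans f⟩

lemma le_specRad_of_iso (e : G ≃g H) {μ : ℝ} {x : V → ℝ} (hx : x ≠ 0)
    (h : ∀ v, ∑ w, (if G.Adj v w then x w else 0) = μ * x v) : μ ≤ specRad H := by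
  refine le_specRad H (x := x ∘ e.symm) ?_ ?_
  · intro h0
    refine hx (funext fun v => ?_)
    simpa using congrFun h0 (e v)
  · intro v
    rw [Function.comp_apply, ← h (e.symm v), ← e.toEquiv.sum_comp]
    refine Finset.sum_congr rfl fun w _ => ?_
    have : H.Adj v (e w) ↔ G.Adj (e.symm v) w := by
      rw [← e.map_adj_iff, RelIso.apply_symm_apply]
    simp [this]

end Iso

section Pendant

variable (s t : ℕ)

@[simp] lemma pendantS_adj_inl_inl (i j : Fin 2) :
    (pendantS s t).Adj (Sum.inl i) (Sum.inl j) ↔ i ≠ j := by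
  simp [pendantS]

@[simp] lemma pendantS_adj_inl_inr_inl (i : Fin 2) (j : Fin s) :
    (pendantS s t).Adj (Sum.inl i) (Sum.inr (Sum.inl j)) := by
  simp [pendantS]

@[simp] lemma pendantS_adj_inr_inl_inl (i : Fin 2) (j : Fin s) :
    (pendantS s t).Adj (Sum.inr (Sum.inl j)) (Sum.inl i) := by
  simp [pendantS]

@[simp] lemma pendantS_adj_inl_inr_inr (i : Fin 2) (j : Fin t) :
    (pendantS s t).Adj (Sum.inl i) (Sum.inr (Sum.inr j)) ↔ i = 0 := by
  simp [pendantS]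

@[simp] lemma pendantS_adj_inr_inr_inl (i : Fin 2) (j : Fin t) :
    (pendantS s t).Adj (Sum.inr (Sum.inr j)) (Sum.inl i) ↔ i = 0 := by
  simp [pendantS]

@[simp] lemma pendantS_not_adj_inr_inr (i j : Fin s ⊕ Fin t) :
    ¬ (pendantS s t).Adj (Sum.inr i) (Sum.inr j) := by
  rcases i with i | i <;> rcases j with j | j <;> simp [pendantS]

lemma not_containsCopy_gem_pendantS : ¬ ContainsCopy gem (pendantS s t) := by
  rintro ⟨f, hf⟩
  have cover : ∀ a b, gem.Adj a b → (f a).isLeft = true ∨ (f b).isLeft = true := by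
    intro a b hab
    have := hf a b hab
    rcases ha : f a with i | i <;> rcases hb : f b with j | j <;> simp_all
  have small : ∀ a b c : Fin 5, a ≠ b → a ≠ c → b ≠ c → (f a).isLeft = true →
      (f b).isLeft = true → (f c).isLeft = true → False := by
    intro a b c hab hac hbc ha hb hc
    obtain ⟨i, hi⟩ := Sum.isLeft_iff.1 ha
    obtain ⟨j, hj⟩ := Sum.isLeft_iff.1 hb
    obtain ⟨k, hk⟩ := Sum.isLeft_iff.1 hc
    have hij : i ≠ j := fun h => hab (f.injective (by rw [hi, hj, h]))
    have hik : i ≠ k := fun h => hac (f.injective (by rw [hi, hk, h]))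
    have hjk : j ≠ k := fun h => hbc (f.injective (by rw [hj, hk, h]))
    omega
  have c01 := cover 0 1 (by simp [gem])
  have c12 := cover 1 2 (by simp [gem])
  have c23 := cover 2 3 (by simp [gem])
  have c04 := cover 0 4 (by simp [gem])
  have c14 := cover 1 4 (by simp [gem])
  have c24 := cover 2 4 (by simp [gem])
  have c34 := cover 3 4 (by simp [gem])
  have s012 := small 0 1 2 (by decide) (by decide) (by decide)
  have s013 := small 0 1 3 (by decide) (by decide) (by decide)
  have s023 := small 0 2 3 (by decide) (by decide) (by decide)
  have s123 := small 1 2 3 (by decide) (by decide) (by decide)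
  have s024 := small 0 2 4 (by decide) (by decide) (by decide)
  have s124 := small 1 2 4 (by decide) (by decide) (by decide)
  have s134 := small 1 3 4 (by decide) (by decide) (by decide)
  have s034 := small 0 3 4 (by decide) (by decide) (by decide)
  grind

lemma edgeCount_pendantS : edgeCount (pendantS s t) = 2 * s + t + 1 := by
  have h := two_mul_edgeCount (pendantS s t)
  simp only [Fintype.sum_sum_type, Fin.sum_univ_two] at h
  simp at h
  have : (edgeCount (pendantS s t) : ℝ) = 2 * s + t + 1 := by linarith
  exact_mod_cast this

lemma not_nonempty_iso_pendantS_bookS {k : ℕ} (hk : 0 < k) (ht : 0 < t) :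
    ¬ Nonempty (pendantS s t ≃g bookS k) := by
  rintro ⟨e⟩
  have two : ∀ v : Fin 2 ⊕ Fin k, ∃ a b, a ≠ b ∧ (bookS k).Adj v a ∧ (bookS k).Adj v b := by
    rintro (i | j)
    · refine ⟨Sum.inl (1 - i), Sum.inr ⟨0, hk⟩, by simp, ?_, by simp [bookS]⟩
      fin_cases i <;> simp [bookS]
    · exact ⟨Sum.inl 0, Sum.inl 1, by simp, by simp [bookS], by simp [bookS]⟩
  have unique : ∀ w, (pendantS s t).Adj (Sum.inr (Sum.inr ⟨0, ht⟩)) w → w = Sum.inl 0 := by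
    rintro (i | j) h
    · simpa using h
    · simp at h
  obtain ⟨a, b, hab, ha, hb⟩ := two (e (Sum.inr (Sum.inr ⟨0, ht⟩)))
  have key : ∀ c, (bookS k).Adj (e (Sum.inr (Sum.inr ⟨0, ht⟩))) c → e.symm c = Sum.inl 0 :=
    fun c hc => unique _ (e.map_adj_iff.1 (by simpa using hc))
  exact hab (e.symm.injective ((key a ha).trans (key b hb).symm))

lemma inFamily_pendantS {m : ℕ} (hm : 2 * s + t + 1 = m) (hs : 0 < s) (ht : 0 < t) :
    InFamily m (pendantS s t) := by
  refine ⟨not_containsCopy_gem_pendantS s t, by rw [edgeCount_pendantS, hm], ?_,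
    not_nonempty_iso_pendantS_bookS s t (by omega) ht⟩
  rintro (i | i | i)
  · exact ⟨Sum.inr (Sum.inl ⟨0, hs⟩), by simp⟩
  · exact ⟨Sum.inl 0, by simp⟩
  · exact ⟨Sum.inl 0, by simp⟩

lemma exists_eigenvalue_pendantS_two :
    ∃ μ : ℝ, 1 < μ ∧ 2 * (s : ℝ) + 1 < μ ^ 2 - μ ∧
      ∃ x : Fin 2 ⊕ (Fin s ⊕ Fin 2) → ℝ, x ≠ 0 ∧
        ∀ v, ∑ w, (if (pendantS s 2).Adj v w then x w else 0) = μ * x v := by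
  have hs : (0 : ℝ) ≤ s := s.cast_nonneg
  let f : ℝ → ℝ := fun μ => (μ ^ 2 - μ - (2 * s + 1)) * (μ ^ 2 + μ - 1) - 1
  obtain ⟨μ, ⟨hμ, -⟩, hroot⟩ : (0 : ℝ) ∈ Set.image f (Set.Icc 1 (2 * s + 3)) := by
    refine intermediate_value_Icc (by linarith) (by fun_prop) ⟨?_, ?_⟩
    · simp only [f]
      nlinarith
    · simp only [f]
      have h1 : 1 ≤ (2 * (s : ℝ) + 3) ^ 2 - (2 * s + 3) - (2 * s + 1) := by nlinarith
      have h2 : 1 ≤ (2 * (s : ℝ) + 3) ^ 2 + (2 * s + 3) - 1 := by nlinarith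
      nlinarith
  simp only [f] at hroot
  have hpos : 0 < μ ^ 2 + μ - 1 := by nlinarith
  have hgt : 2 * (s : ℝ) + 1 < μ ^ 2 - μ := by
    by_contra! hle
    nlinarith
  have hμ0 : μ ≠ 0 := by positivity
  refine ⟨μ, by nlinarith, hgt,
    Sum.elim ![μ * (μ ^ 2 - s), μ * (μ + s)]
      (Sum.elim (fun _ => μ ^ 2 + μ) (fun _ => μ ^ 2 - s)), ?_, ?_⟩
  · intro h0
    have := congrFun h0 (Sum.inl 1)
    simp at this
    rcases this with h | h
    · exact hμ0 h
    · linarith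
  · rintro (i | i | i)
    · fin_cases i
      · simp [Fintype.sum_sum_type, Fin.sum_univ_two]
        linear_combination -hroot
      · simp [Fintype.sum_sum_type, Fin.sum_univ_two]
        ring
    · simp [Fintype.sum_sum_type, Fin.sum_univ_two]
      ring
    · simp [Fintype.sum_sum_type]

end Pendant

lemma MaxInFamily.sub_two_lt {V : Type*} [Fintype V] {G : SimpleGraph V} {m : ℕ}
    (hodd : Odd m) (hm : 5 ≤ m) (hmax : MaxInFamily m G) :
    (m : ℝ) - 2 < specRad G ^ 2 - specRad G := by
  obtain ⟨k, rfl⟩ := hodd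
  obtain ⟨s, rfl⟩ : ∃ s, k = s + 1 := ⟨k - 1, by omega⟩
  obtain ⟨μ, h1, hμ, x, hx, heig⟩ := exists_eigenvalue_pendantS_two s
  have e := (pendantS s 2).overFinIso rfl
  have hle : μ ≤ specRad G := (le_specRad_of_iso e hx heig).trans
    (hmax.2 _ _ ((inFamily_pendantS s 2 (by ring) (by omega) (by norm_num)).of_iso e))
  push_cast
  nlinarith

theorem stmt13 {V : Type*} [Fintype V] (G : SimpleGraph V) (m : ℕ)
    (hodd : Odd m) (hm : 23 ≤ m) (hmax : MaxInFamily m G)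
    (x : V → ℝ) (hx : ∀ v, 0 < x v)
    (heig : G.adjMatrix ℝ *ᵥ x = specRad G • x)
    (u : V) (hu : ∀ v, x v ≤ x u) :
    (edgesIn G (Wset G u) : ℝ) <
      (edgesIn G (Nplus G u) : ℝ) - (Nplus G u).card + 2 -
        ∑ v ∈ N0 G u, x v / x u := by
  have hρ := hmax.sub_two_lt hodd (by omega)
  have hcount := two_mul_edgeCount G
  rw [hmax.1.2.1] at hcount
  have hP := two_mul_edgesIn G (Nplus G u)
  have hW := two_mul_edgesIn G (Wset G u)
  have hsplit := sum_eq_add_sum_neighborFinset_add_sum_Wset G u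
  set ρ := specRad G
  set N := G.neighborFinset u
  set W := Wset G u with hWdef
  set P := Nplus G u
  set Z := N0 G u
  set a : V → V → ℝ := fun v w => if G.Adj v w then (1 : ℝ) else 0 with ha
  set y : V → ℝ := fun v => x v / x u with hy
  have hxu := hx u
  have hyu : y u = 1 := div_self hxu.ne'
  have hy1 : ∀ v, y v ≤ 1 := fun v => (div_le_one hxu).2 (hu v)
  have ha0 : ∀ v w, 0 ≤ a v w := fun v w => by simp only [ha]; split_ifs <;> norm_num
  have hsymm : ∀ v w, a v w = a w v := fun v w => by simp only [ha, G.adj_comm]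
  have hauu : a u u = 0 := by simp [ha]
  have haN : ∀ v ∈ N, a v u = 1 := fun v hv => by
    have : G.Adj v u := ((G.mem_neighborFinset u v).1 hv).symm
    simp [ha, this]
  have haW : ∀ v ∈ W, a v u = 0 := fun v hv => by
    have : ¬ G.Adj v u := fun h => by simp [hWdef, Wset, h.symm] at hv
    simp [ha, this]
  have hrow : ∀ v, ∑ w, a v w * y w = ρ * y v := by
    intro v
    have := congrFun heig v
    simp only [Matrix.mulVec, dotProduct, adjMatrix_apply, Pi.smul_apply, smul_eq_mul] at this
    simp only [hy, ha, ← mul_div_assoc, ← Finset.sum_div]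
    rw [this]
  have hsub : Z ⊆ N := Finset.filter_subset _ _
  have hNsplit : ∀ f : V → ℝ, ∑ v ∈ N, f v = ∑ v ∈ Z, f v + ∑ v ∈ P, f v := fun f => by
    rw [add_comm]
    exact (Finset.sum_sdiff hsub).symm
  have haZ : ∀ v ∈ Z, ∀ w ∈ N, a v w = 0 := fun v hv w hw => by
    have : ¬ G.Adj v w := (Finset.mem_filter.1 hv).2 w hw
    simp [ha, this]
  have hPN : ∀ v ∈ P, v ∈ N := fun v hv => (Finset.mem_sdiff.1 hv).1
  set D : V → ℝ := fun v => ∑ w ∈ N, a v w with hD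
  have hDZ : ∀ v ∈ Z, D v = 0 := fun v hv => Finset.sum_eq_zero (haZ v hv)
  have hDP : ∀ v ∈ P, 1 ≤ D v := fun v hv => by
    obtain ⟨hvN, hvZ⟩ := Finset.mem_sdiff.1 hv
    have : ∃ w ∈ N, G.Adj v w := by
      by_contra! h
      exact hvZ (Finset.mem_filter.2 ⟨hvN, h⟩)
    obtain ⟨w, hw, hvw⟩ := this
    calc (1 : ℝ) = a v w := by simp [ha, hvw]
      _ ≤ D v := Finset.single_le_sum (fun w _ => ha0 v w) hw
  have hDsum : ∑ v ∈ N, D v = ∑ v ∈ P, D v := by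
    rw [hNsplit, Finset.sum_eq_zero hDZ, zero_add]
  have hPD : 2 * (edgesIn G P : ℝ) = ∑ v ∈ P, D v := by
    rw [hP]
    refine Finset.sum_congr rfl fun v hv => ?_
    simp only [hD]
    rw [hNsplit, Finset.sum_eq_zero (s := Z) fun w hw => ?_, zero_add]
    rw [hsymm]
    exact haZ w hw v (hPN v hv)
  set E : ℝ := ∑ v ∈ N, ∑ w ∈ W, a v w with hE
  have hE' : ∑ v ∈ W, ∑ w ∈ N, a v w = E := by
    rw [hE, Finset.sum_comm]
    exact Finset.sum_congr rfl fun v _ => Finset.sum_congr rfl fun w _ => hsymm _ _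
  have hm2 : 2 * (m : ℝ) = 2 * N.card + ∑ v ∈ P, D v + 2 * E + 2 * edgesIn G W := by
    have h1 : ∑ w, a u w = N.card := by
      rw [hsplit, hauu, Finset.sum_congr rfl fun w hw => (hsymm u w).trans (haN w hw),
        Finset.sum_eq_zero fun w hw => (hsymm u w).trans (haW w hw)]
      simp
    have h2 : ∑ v ∈ N, ∑ w, a v w = N.card + ∑ v ∈ P, D v + E := by
      rw [← hDsum, Finset.sum_congr rfl fun v hv => (hsplit (a v)).trans (by rw [haN v hv])]
      simp [Finset.sum_add_distrib, hD, hE]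
    have h3 : ∑ v ∈ W, ∑ w, a v w = E + 2 * edgesIn G W := by
      rw [hW, ← hE', ← Finset.sum_add_distrib]
      exact Finset.sum_congr rfl fun v hv => by rw [hsplit, haW v hv, zero_add]
    rw [hcount, hsplit, h1, h2, h3]
    ring
  have hρN : ρ = ∑ v ∈ N, y v := by
    have := hrow u
    rw [hyu, mul_one, hsplit, hauu] at this
    rw [← this, Finset.sum_eq_zero (s := W) fun w hw => by rw [hsymm, haW w hw, zero_mul]]
    rw [zero_mul, zero_add, add_zero]
    exact Finset.sum_congr rfl fun w hw => by rw [hsymm, haN w hw, one_mul]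
  have hρ2 : ρ ^ 2 = N.card + ∑ v ∈ N, D v * y v + ∑ v ∈ N, ∑ w ∈ W, a v w * y w := by
    have h1 : ∑ v ∈ N, D v * y v = ∑ v ∈ N, ∑ w ∈ N, a v w * y w := by
      rw [Finset.sum_comm]
      refine Finset.sum_congr rfl fun v _ => ?_
      rw [hD, Finset.sum_mul]
      exact Finset.sum_congr rfl fun w _ => by rw [hsymm]
    calc ρ ^ 2 = ∑ v ∈ N, ρ * y v := by rw [← Finset.mul_sum, ← hρN, sq]
      _ = ∑ v ∈ N, (1 + ∑ w ∈ N, a v w * y w + ∑ w ∈ W, a v w * y w) :=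
        Finset.sum_congr rfl fun v hv => by rw [← hrow, hsplit, haN v hv, hyu, one_mul]
      _ = _ := by simp [Finset.sum_add_distrib, h1]
  have hEle : ∑ v ∈ N, ∑ w ∈ W, a v w * y w ≤ E :=
    Finset.sum_le_sum fun v _ => Finset.sum_le_sum fun w _ =>
      mul_le_of_le_one_right (ha0 v w) (hy1 w)
  have hDle : ∑ v ∈ N, D v * y v - ∑ v ∈ N, y v ≤
      ∑ v ∈ P, D v - P.card - ∑ v ∈ Z, y v := by
    have hZ0 : ∑ v ∈ Z, D v * y v = 0 :=
      Finset.sum_eq_zero fun v hv => by rw [hDZ v hv, zero_mul]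
    have hP1 : ∑ v ∈ P, (D v * y v - y v) ≤ ∑ v ∈ P, (D v - 1) :=
      Finset.sum_le_sum fun v hv => by nlinarith [hDP v hv, hy1 v]
    simp only [Finset.sum_sub_distrib, Finset.sum_const, nsmul_eq_mul, mul_one] at hP1
    rw [hNsplit, hNsplit, hZ0]
    linarith
  linarith
end

section
/- Every gem-free graph G with m ≥ 11 edges and no isolated vertices satisfies ρ(G) ≤ ρ(S_{(m+3)/2,2}), with equality iff G ≅ S_{(m+3)/2,2} = K_2 ∨ ((m−1)/2)K_1. -/
open scoped Classical
open SimpleGraph Matrix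

theorem gem_free_no_hub_path {V : Type*} {G : SimpleGraph V} (hgf : ¬ ContainsCopy gem G)
    {h p q r s : V} (hp : G.Adj h p) (hq : G.Adj h q) (hr : G.Adj h r) (hs : G.Adj h s)
    (hpq : G.Adj p q) (hqr : G.Adj q r) (hrs : G.Adj r s)
    (h₁ : p ≠ r) (h₂ : p ≠ s) (h₃ : q ≠ s) : False := by
  apply hgf
  have := hp.ne; have := hq.ne; have := hr.ne; have := hs.ne
  have := hpq.ne; have := hqr.ne; have := hrs.ne
  refine ⟨⟨![p, q, r, s, h], ?_⟩, ?_⟩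
  · intro a b hab
    fin_cases a <;> fin_cases b <;> simp_all
  · intro a b hab
    fin_cases a <;> fin_cases b <;> simp [gem] at hab ⊢ <;>
      first | assumption | exact SimpleGraph.Adj.symm ‹_›

theorem hasEigenvalue_iff_exists {V : Type*} [Fintype V] (A : Matrix V V ℝ) (μ : ℝ) :
    Module.End.HasEigenvalue (Matrix.mulVecLin A) μ ↔ ∃ y, y ≠ 0 ∧ A *ᵥ y = μ • y := by
  constructor
  · intro h
    obtain ⟨y, hy⟩ := h.exists_hasEigenvector
    exact ⟨y, hy.2, by simpa using hy.apply_eq_smul⟩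
  · rintro ⟨y, hy, h⟩
    exact Module.End.hasEigenvalue_of_hasEigenvector
      (Module.End.hasEigenvector_iff.2 ⟨Module.End.mem_eigenspace_iff.2 (by simpa using h), hy⟩)

theorem finite_setOf_hasEigenvalue {V : Type*} [Fintype V] (A : Matrix V V ℝ) :
    {μ : ℝ | Module.End.HasEigenvalue (Matrix.mulVecLin A) μ}.Finite :=
  Module.End.finite_hasEigenvalue _

theorem le_specRad_s16 {V : Type*} [Fintype V] (G : SimpleGraph V) {μ : ℝ} {y : V → ℝ} (hy : y ≠ 0)
    (h : G.adjMatrix ℝ *ᵥ y = μ • y) : μ ≤ specRad G :=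
  le_csSup (finite_setOf_hasEigenvalue _).bddAbove ((hasEigenvalue_iff_exists _ _).2 ⟨y, hy, h⟩)

theorem specRad_hasEigenvalue {V : Type*} [Fintype V] [Nonempty V] (G : SimpleGraph V) :
    ∃ y, y ≠ 0 ∧ G.adjMatrix ℝ *ᵥ y = specRad G • y := by
  rw [← hasEigenvalue_iff_exists]
  refine Set.Nonempty.csSup_mem (s := {μ : ℝ | Module.End.HasEigenvalue _ μ}) ?_
    (finite_setOf_hasEigenvalue _)
  have hA : (G.adjMatrix ℝ).IsHermitian := by
    rw [Matrix.IsHermitian, Matrix.conjTranspose_eq_transpose_of_trivial]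
    exact G.isSymm_adjMatrix
  obtain ⟨v⟩ := ‹Nonempty V›
  refine ⟨hA.eigenvalues v, (hasEigenvalue_iff_exists _ _).2
    ⟨_, ?_, hA.mulVec_eigenvectorBasis v⟩⟩
  intro h
  apply hA.eigenvectorBasis.orthonormal.ne_zero v
  ext i
  exact congrFun h i

theorem posSemidef_specRad_sub_adjMatrix {V : Type*} [Fintype V] (G : SimpleGraph V) :
    (specRad G • (1 : Matrix V V ℝ) - G.adjMatrix ℝ).PosSemidef := by
  have hB : (specRad G • (1 : Matrix V V ℝ) - G.adjMatrix ℝ).IsHermitian := by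
    rw [Matrix.IsHermitian, Matrix.conjTranspose_eq_transpose_of_trivial]
    simp [G.isSymm_adjMatrix.eq]
  rw [hB.posSemidef_iff_eigenvalues_nonneg]
  intro v
  have h := hB.mulVec_eigenvectorBasis v
  have hne : (hB.eigenvectorBasis v).ofLp ≠ 0 := by
    intro h
    apply hB.eigenvectorBasis.orthonormal.ne_zero v
    ext i
    exact congrFun h i
  have : specRad G - hB.eigenvalues v ≤ specRad G := by
    refine le_specRad_s16 G hne ?_
    rw [Matrix.sub_mulVec, Matrix.smul_mulVec, Matrix.one_mulVec] at h
    rw [sub_smul, ← h]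
    simp
  simpa using this

theorem exists_nonneg_eigenvector {V : Type*} [Fintype V] [Nonempty V] (G : SimpleGraph V) :
    ∃ (x : V → ℝ) (u : V), (∀ v, 0 ≤ x v) ∧ (∀ v, x v ≤ 1) ∧ x u = 1 ∧
      ∀ v, specRad G * x v = ∑ w, G.adjMatrix ℝ v w * x w := by
  obtain ⟨y, hy, hev⟩ := specRad_hasEigenvalue G
  have key : G.adjMatrix ℝ *ᵥ (fun v => |y v|) = specRad G • fun v => |y v| := by
    have hP := posSemidef_specRad_sub_adjMatrix G
    have h0 : (star fun v => |y v|) ⬝ᵥ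
        ((specRad G • (1 : Matrix V V ℝ) - G.adjMatrix ℝ) *ᵥ fun v => |y v|) = 0 := by
      refine le_antisymm ?_ (hP.dotProduct_mulVec_nonneg _)
      have h1 : y ⬝ᵥ (G.adjMatrix ℝ *ᵥ y) ≤
          (fun v => |y v|) ⬝ᵥ (G.adjMatrix ℝ *ᵥ fun v => |y v|) := by
        simp only [dotProduct, mulVec, Finset.mul_sum]
        refine Finset.sum_le_sum fun i _ => Finset.sum_le_sum fun j _ => ?_
        simp only [adjMatrix_apply]
        split_ifs
        · rw [one_mul, one_mul, ← abs_mul]; exact le_abs_self _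
        · simp
      have h2 : y ⬝ᵥ y = (fun v => |y v|) ⬝ᵥ fun v => |y v| := by simp [dotProduct]
      rw [hev, dotProduct_smul, h2] at h1
      rw [Matrix.sub_mulVec, Matrix.smul_mulVec, Matrix.one_mulVec, dotProduct_sub,
        dotProduct_smul]
      simp only [star_trivial]
      linarith
    have := (hP.dotProduct_mulVec_zero_iff _).1 h0
    rw [Matrix.sub_mulVec, Matrix.smul_mulVec, Matrix.one_mulVec, sub_eq_zero] at this
    exact this.symm
  obtain ⟨u, hu⟩ := Finite.exists_max fun v => |y v|
  have hpos : 0 < |y u| := by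
    obtain ⟨v, hv⟩ := Function.ne_iff.1 hy
    exact (abs_pos.2 hv).trans_le (hu v)
  refine ⟨fun v => |y v| / |y u|, u, fun v => by positivity,
    fun v => (div_le_one hpos).2 (hu v), div_self hpos.ne', fun v => ?_⟩
  have := congrFun key v
  simp only [mulVec, dotProduct, Pi.smul_apply, smul_eq_mul] at this
  rw [mul_div_assoc', ← this, Finset.sum_div]
  exact Finset.sum_congr rfl fun w _ => (mul_div_assoc ..)

theorem exists_eigenvector_of_iso {V W : Type*} [Fintype V] [Fintype W] {G : SimpleGraph V}
    {H : SimpleGraph W} (e : G ≃g H) {μ : ℝ} (h : ∃ y, y ≠ 0 ∧ H.adjMatrix ℝ *ᵥ y = μ • y) :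
    ∃ y, y ≠ 0 ∧ G.adjMatrix ℝ *ᵥ y = μ • y := by
  obtain ⟨y, hy, h⟩ := h
  refine ⟨y ∘ e, fun h0 => hy ?_, ?_⟩
  · ext w
    simpa using congrFun h0 (e.symm w)
  · ext v
    have := congrFun h (e v)
    simp only [mulVec, dotProduct, Pi.smul_apply, Function.comp_apply] at this ⊢
    rw [← this]
    refine Fintype.sum_equiv e.toEquiv _ _ fun w => ?_
    have hvw : H.Adj (e v) (e w) ↔ G.Adj v w := e.map_adj_iff
    simp [adjMatrix_apply, hvw]

theorem specRad_eq_of_iso {V W : Type*} [Fintype V] [Fintype W] {G : SimpleGraph V}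
    {H : SimpleGraph W} (e : G ≃g H) : specRad G = specRad H := by
  unfold specRad
  simp only [hasEigenvalue_iff_exists]
  congr 1
  ext μ
  exact ⟨exists_eigenvector_of_iso e.symm, exists_eigenvector_of_iso e⟩

theorem le_specRad_bookS (k : ℕ) : (1 + √(1 + 8 * k)) / 2 ≤ specRad (bookS k) := by
  set r : ℝ := (1 + √(1 + 8 * k)) / 2 with hr
  have hsq : √(1 + 8 * (k : ℝ)) ^ 2 = 1 + 8 * k := Real.sq_sqrt (by positivity)
  have hrr : r * r = r + 2 * k := by rw [hr]; nlinarith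
  refine le_specRad_s16 (bookS k) (y := Sum.elim (fun _ => r) fun _ => 2) ?_ ?_
  · intro h
    have h1 := congrFun h (Sum.inl 0)
    have : 0 < r := by positivity
    simp at h1
    linarith
  · ext v
    simp only [mulVec, dotProduct, Fintype.sum_sum_type, adjMatrix_apply, Pi.smul_apply,
      smul_eq_mul, Fin.sum_univ_two]
    rcases v with v | v
    · fin_cases v <;> simp [bookS] <;> linarith
    · simp [bookS]; ring

theorem sum_sum_eq_of_symm {V : Type*} {s : Finset V} {c : V} (hc : c ∈ s) {F : V → V → ℝ}
    (hF : ∀ v w, F v w = F w v) (h0 : F c c = 0) :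
    ∑ v ∈ s, ∑ w ∈ s, F v w =
      2 * ∑ w ∈ s, F c w + ∑ v ∈ s.erase c, ∑ w ∈ s.erase c, F v w := by
  have h1 : ∀ v, ∑ w ∈ s, F v w = F v c + ∑ w ∈ s.erase c, F v w := fun v =>
    (Finset.add_sum_erase s _ hc).symm
  rw [← Finset.add_sum_erase s _ hc]
  simp only [h1, Finset.sum_add_distrib, h0, hF _ c]
  ring

/-- The number of neighbours of `v` in `s`, as a real number. -/
noncomputable def degIn {V : Type*} (G : SimpleGraph V) (s : Finset V) (v : V) : ℝ :=
  ∑ w ∈ s, G.adjMatrix ℝ v w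

theorem adjMatrix_nonneg {V : Type*} (G : SimpleGraph V) (v w : V) :
    0 ≤ G.adjMatrix ℝ v w := by
  rw [adjMatrix_apply]; split_ifs <;> norm_num

theorem adjMatrix_comm {V : Type*} (G : SimpleGraph V) (v w : V) :
    G.adjMatrix ℝ v w = G.adjMatrix ℝ w v := by
  simp [adjMatrix_apply, G.adj_comm]

theorem degIn_eq_card {V : Type*} (G : SimpleGraph V) (s : Finset V) (v : V) :
    degIn G s v = ((s.filter (G.Adj v)).card : ℝ) := by
  simp [degIn, adjMatrix_apply]

theorem degIn_nonneg {V : Type*} (G : SimpleGraph V) (s : Finset V) (v : V) :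
    0 ≤ degIn G s v := by
  rw [degIn_eq_card]; positivity

theorem one_le_degIn {V : Type*} {G : SimpleGraph V} {s : Finset V} {v w : V} (hw : w ∈ s)
    (h : G.Adj v w) : 1 ≤ degIn G s v := by
  rw [degIn_eq_card, Nat.one_le_cast, Nat.one_le_iff_ne_zero, Finset.card_ne_zero]
  exact ⟨w, by simp [hw, h]⟩

theorem exists_adj_of_degIn_ne_zero {V : Type*} {G : SimpleGraph V} {s : Finset V} {v : V}
    (h : degIn G s v ≠ 0) : ∃ w ∈ s, G.Adj v w := by
  rw [degIn_eq_card, Nat.cast_ne_zero, Finset.card_ne_zero] at h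
  obtain ⟨w, hw⟩ := h
  exact ⟨w, by simpa using hw⟩

theorem exists_adj_ne_of_degIn_ne_one {V : Type*} {G : SimpleGraph V} {s : Finset V} {v w : V}
    (hw : w ∈ s) (hvw : G.Adj v w) (h : degIn G s v ≠ 1) : ∃ z ∈ s, G.Adj v z ∧ z ≠ w := by
  by_contra! hcon
  apply h
  have : s.filter (G.Adj v) = {w} := by
    ext z
    simp only [Finset.mem_filter, Finset.mem_singleton]
    constructor
    · rintro ⟨h1, h2⟩; exact hcon z h1 h2
    · rintro rfl; exact ⟨hw, hvw⟩
  rw [degIn_eq_card, this]; simp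

theorem degIn_eq_two {V : Type*} {G : SimpleGraph V} {s : Finset V} {v w z : V} (hw : w ∈ s)
    (hz : z ∈ s) (hvw : G.Adj v w) (hvz : G.Adj v z) (hwz : w ≠ z)
    (h : ∀ y ∈ s, G.Adj v y → y = w ∨ y = z) : degIn G s v = 2 := by
  have : s.filter (G.Adj v) = {w, z} := by
    ext y
    simp only [Finset.mem_filter, Finset.mem_singleton, Finset.mem_insert]
    constructor
    · rintro ⟨h1, h2⟩; exact h y h1 h2
    · rintro (rfl | rfl)
      exacts [⟨hw, hvw⟩, ⟨hz, hvz⟩]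
  rw [degIn_eq_card, this, Finset.card_pair hwz]; norm_num

theorem degIn_eq_one {V : Type*} {G : SimpleGraph V} {s : Finset V} {v w : V} (hw : w ∈ s)
    (hvw : G.Adj v w) (h : ∀ y ∈ s, G.Adj v y → y = w) : degIn G s v = 1 := by
  by_contra hne
  obtain ⟨z, hz, hvz, hzw⟩ := exists_adj_ne_of_degIn_ne_one hw hvw hne
  exact hzw (h z hz hvz)

theorem eq_of_degIn_eq_one {V : Type*} {G : SimpleGraph V} {s : Finset V} {v w z : V}
    (h : degIn G s v = 1) (hw : w ∈ s) (hz : z ∈ s) (hvw : G.Adj v w) (hvz : G.Adj v z) :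
    w = z := by
  rw [degIn_eq_card, Nat.cast_eq_one] at h
  exact Finset.card_le_one.1 h.le w (by simp [hw, hvw]) z (by simp [hz, hvz])

theorem sum_degIn_comm {V : Type*} (G : SimpleGraph V) (s t : Finset V) (f : V → ℝ) :
    ∑ v ∈ s, ∑ w ∈ t, G.adjMatrix ℝ v w * f w = ∑ w ∈ t, degIn G s w * f w := by
  rw [Finset.sum_comm]
  refine Finset.sum_congr rfl fun w _ => ?_
  rw [degIn, Finset.sum_mul]
  exact Finset.sum_congr rfl fun v _ => by rw [adjMatrix_comm]

/-- The number of neighbours inside `s` is at most the number of edges inside `s`. -/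
theorem degIn_le_half_sum {V : Type*} {G : SimpleGraph V} {s : Finset V} {w : V} (hw : w ∈ s) :
    degIn G s w ≤ (∑ v ∈ s, degIn G s v) / 2 := by
  have h := sum_sum_eq_of_symm hw (adjMatrix_comm G) (by simp)
  have h0 : 0 ≤ ∑ v ∈ s.erase w, ∑ y ∈ s.erase w, G.adjMatrix ℝ v y :=
    Finset.sum_nonneg fun v _ => Finset.sum_nonneg fun y _ => adjMatrix_nonneg G v y
  unfold degIn
  linarith

/-- In a gem-free graph, an edge inside the neighbourhood of `u` neither of whose ends is a leaf
there lies in a triangle which is a component of that neighbourhood. -/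
theorem exists_triangle {V : Type*} [Fintype V] {G : SimpleGraph V}
    (hgf : ¬ ContainsCopy gem G) {u v w : V} (hv : v ∈ G.neighborFinset u)
    (hw : w ∈ G.neighborFinset u) (hvw : G.Adj v w) (h1 : degIn G (G.neighborFinset u) v ≠ 1)
    (h2 : degIn G (G.neighborFinset u) w ≠ 1) :
    ∃ z ∈ G.neighborFinset u, G.Adj v z ∧ G.Adj w z ∧
      (∀ y ∈ G.neighborFinset u, G.Adj v y → y = w ∨ y = z) ∧
      (∀ y ∈ G.neighborFinset u, G.Adj w y → y = v ∨ y = z) ∧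
      (∀ y ∈ G.neighborFinset u, G.Adj z y → y = v ∨ y = w) := by
  have key : ∀ a b c d : V, a ∈ G.neighborFinset u → b ∈ G.neighborFinset u →
      c ∈ G.neighborFinset u → d ∈ G.neighborFinset u → G.Adj a b → G.Adj b c → G.Adj c d →
      a ≠ c → b ≠ d → a = d := by
    intro a b c d ha hb hc hd hab hbc hcd hac hbd
    by_contra had
    simp only [mem_neighborFinset] at ha hb hc hd
    exact gem_free_no_hub_path hgf ha hb hc hd hab hbc hcd hac had hbd
  obtain ⟨z, hz, hvz, hzw⟩ := exists_adj_ne_of_degIn_ne_one hw hvw h1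
  obtain ⟨y, hy, hwy, hyv⟩ := exists_adj_ne_of_degIn_ne_one hv hvw.symm h2
  obtain rfl := key z v w y hz hv hw hy hvz.symm hvw hwy hzw hyv.symm
  refine ⟨z, hz, hvz, hwy, fun y hy hvy => ?_, fun y hy hwy' => ?_, fun y hy hzy => ?_⟩
  · by_contra! h
    exact h.2 (key z w v y hz hw hv hy hwy.symm hvw.symm hvy hyv h.1.symm).symm
  · by_contra! h
    exact h.2 (key z v w y hz hv hw hy hvz.symm hvw hwy' hzw h.1.symm).symm
  · by_contra! h
    exact h.2 (key w v z y hw hv hz hy hvw.symm hvz hzy hzw.symm h.1.symm).symm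

theorem two_mul_edgeCount_eq_sum {V : Type*} [Fintype V] (G : SimpleGraph V) :
    2 * (edgeCount G : ℝ) = ∑ v, ∑ w, G.adjMatrix ℝ v w := by
  have h : (∑ v, (G.degree v : ℝ)) = 2 * (G.edgeFinset.card : ℝ) := by
    exact_mod_cast G.sum_degrees_eq_twice_card_edges
  rw [edgeCount, ← h]
  refine Finset.sum_congr rfl fun v _ => ?_
  simp [adjMatrix_apply, ← card_neighborFinset_eq_degree, neighborFinset_eq_filter]

section Extremal

variable {V : Type*} [Fintype V] (G : SimpleGraph V) (u : V)

theorem sum_eq_add_neighborFinset_add_Wset (f : V → ℝ) :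
    ∑ w, f w = f u + ∑ w ∈ G.neighborFinset u, f w + ∑ w ∈ Wset G u, f w := by
  rw [Wset, ← Finset.sum_insert (by simp), add_comm, Finset.sum_sdiff (Finset.subset_univ _)]

theorem adjMatrix_of_mem_Wset {w : V} (hw : w ∈ Wset G u) : G.adjMatrix ℝ u w = 0 := by
  simp only [Wset, Finset.mem_sdiff, Finset.mem_insert, mem_neighborFinset, not_or] at hw
  simp [hw.2.2]

theorem adjMatrix_of_mem_neighborFinset {w : V} (hw : w ∈ G.neighborFinset u) :
    G.adjMatrix ℝ u w = 1 := by
  simpa using hw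

theorem two_mul_edgeCount_s16 :
    2 * (edgeCount G : ℝ) = 2 * (G.neighborFinset u).card +
      ∑ v ∈ G.neighborFinset u, degIn G (G.neighborFinset u) v +
      2 * ∑ w ∈ Wset G u, degIn G (G.neighborFinset u) w +
      ∑ w ∈ Wset G u, degIn G (Wset G u) w := by
  have hN := Finset.sum_congr rfl fun w (hw : w ∈ G.neighborFinset u) =>
    adjMatrix_of_mem_neighborFinset G u hw
  have hN' := Finset.sum_congr rfl fun w (hw : w ∈ G.neighborFinset u) =>
    (adjMatrix_comm G w u).trans (adjMatrix_of_mem_neighborFinset G u hw)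
  have hW := Finset.sum_congr rfl fun w (hw : w ∈ Wset G u) => adjMatrix_of_mem_Wset G u hw
  have hW' := Finset.sum_congr rfl fun w (hw : w ∈ Wset G u) =>
    (adjMatrix_comm G w u).trans (adjMatrix_of_mem_Wset G u hw)
  have hc := sum_degIn_comm G (G.neighborFinset u) (Wset G u) fun _ => 1
  simp only [mul_one] at hc
  rw [two_mul_edgeCount_eq_sum]
  simp only [sum_eq_add_neighborFinset_add_Wset G u, Finset.sum_add_distrib, hN, hN', hW, hW', hc]
  simp [degIn]
  ring

variable {G u} {x : V → ℝ} {l : ℝ}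

theorem eigen_split (hev : ∀ v, l * x v = ∑ w, G.adjMatrix ℝ v w * x w) (v : V) :
    l * x v = G.adjMatrix ℝ v u * x u + ∑ w ∈ G.neighborFinset u, G.adjMatrix ℝ v w * x w +
      ∑ w ∈ Wset G u, G.adjMatrix ℝ v w * x w := by
  rw [hev, sum_eq_add_neighborFinset_add_Wset G u]

theorem eigen_apply_max (hxu : x u = 1) (hev : ∀ v, l * x v = ∑ w, G.adjMatrix ℝ v w * x w) :
    l = ∑ w ∈ G.neighborFinset u, x w := by
  have := eigen_split (u := u) hev u
  rw [hxu, mul_one] at this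
  rw [this, Finset.sum_eq_zero (s := Wset G u) fun w hw => by
    rw [adjMatrix_of_mem_Wset G u hw, zero_mul]]
  simp only [adjMatrix_apply, SimpleGraph.irrefl, if_false, zero_mul, zero_add, add_zero]
  refine Finset.sum_congr rfl fun w hw => ?_
  simp [(mem_neighborFinset ..).1 hw]

theorem eigen_sq (hxu : x u = 1) (hev : ∀ v, l * x v = ∑ w, G.adjMatrix ℝ v w * x w) :
    l * l = (G.neighborFinset u).card +
      ∑ v ∈ G.neighborFinset u, degIn G (G.neighborFinset u) v * x v +
      ∑ w ∈ Wset G u, degIn G (G.neighborFinset u) w * x w := by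
  conv_lhs => rw [eigen_apply_max hxu hev, Finset.mul_sum, ← eigen_apply_max hxu hev]
  rw [Finset.sum_congr rfl fun v _ => eigen_split (u := u) hev v, Finset.sum_add_distrib,
    Finset.sum_add_distrib, sum_degIn_comm, sum_degIn_comm]
  rw [Finset.sum_congr rfl fun w (hw : w ∈ G.neighborFinset u) => by
    rw [adjMatrix_comm, adjMatrix_of_mem_neighborFinset G u hw, hxu]]
  simp

theorem loss_le_one (hxu : x u = 1) (hev : ∀ v, l * x v = ∑ w, G.adjMatrix ℝ v w * x w)
    (hl : (edgeCount G : ℝ) - 1 ≤ l * l - l) :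
    ∑ v ∈ G.neighborFinset u, (degIn G (G.neighborFinset u) v / 2 -
        (degIn G (G.neighborFinset u) v - 1) * x v) +
      ∑ w ∈ Wset G u, degIn G (G.neighborFinset u) w * (1 - x w) +
      (∑ w ∈ Wset G u, degIn G (Wset G u) w) / 2 ≤ 1 := by
  have h1 := two_mul_edgeCount_s16 G u
  have h2 := eigen_sq hxu hev
  have h3 := eigen_apply_max hxu hev
  simp only [sub_mul, mul_sub, Finset.sum_sub_distrib, mul_one, one_mul, ← Finset.sum_div]
  linarith


theorem not_adj_of_mem_Wset {w : V} (hw : w ∈ Wset G u) : w ≠ u ∧ ¬ G.Adj u w := by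
  simpa [Wset] using hw

/-- In a gem-free graph, a vertex outside a `K₄` is adjacent to at most one vertex of a triangle
of the `K₄`, unless it is adjacent to the fourth vertex. -/
theorem not_adj_two_of_triangle (hgf : ¬ ContainsCopy gem G) {p q r w : V} (hp : G.Adj u p)
    (hq : G.Adj u q) (hr : G.Adj u r) (hpq : G.Adj p q) (hpr : G.Adj p r) (hqr : G.Adj q r)
    (hw : w ∈ Wset G u) (hwp : G.Adj w p) : ¬ G.Adj w q := by
  intro hwq
  obtain ⟨hwu, huw⟩ := not_adj_of_mem_Wset hw
  refine gem_free_no_hub_path hgf hwp.symm hpq hp.symm hpr hwq hq.symm hr hwu ?_ hqr.ne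
  rintro rfl
  exact huw hr

theorem adjMatrix_triangle_le (hgf : ¬ ContainsCopy gem G) {p q r w : V} (hp : G.Adj u p)
    (hq : G.Adj u q) (hr : G.Adj u r) (hpq : G.Adj p q) (hpr : G.Adj p r) (hqr : G.Adj q r)
    (hw : w ∈ Wset G u) :
    G.adjMatrix ℝ w p + (G.adjMatrix ℝ w q + G.adjMatrix ℝ w r) ≤ 1 := by
  have h1 := not_adj_two_of_triangle hgf hp hq hr hpq hpr hqr hw
  have h2 := not_adj_two_of_triangle hgf hp hr hq hpr hpq hqr.symm hw
  have h3 := not_adj_two_of_triangle hgf hq hr hp hqr hpq.symm hpr.symm hw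
  simp only [adjMatrix_apply]
  by_cases a : G.Adj w p <;> by_cases b : G.Adj w q <;> by_cases c : G.Adj w r <;> simp_all

theorem exists_leaf_of_loss_le_one (hgf : ¬ ContainsCopy gem G) (hx0 : ∀ v, 0 ≤ x v)
    (hx1 : ∀ v, x v ≤ 1) (hxu : x u = 1) (hev : ∀ v, l * x v = ∑ w, G.adjMatrix ℝ v w * x w)
    (hl : (edgeCount G : ℝ) - 1 ≤ l * l - l) (hl' : 3.7 ≤ l) :
    ∃ v ∈ G.neighborFinset u, degIn G (G.neighborFinset u) v = 1 := by
  by_contra! hno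
  have hL := loss_le_one hxu hev hl
  have hlam := eigen_apply_max hxu hev
  set N := G.neighborFinset u with hN
  set P := N.filter fun v => degIn G N v ≠ 0 with hP
  set Z := N.filter fun v => ¬ degIn G N v ≠ 0 with hZ
  have hsplit : ∀ f : V → ℝ, ∑ v ∈ N, f v = ∑ v ∈ P, f v + ∑ v ∈ Z, f v := fun f =>
    (Finset.sum_filter_add_sum_filter_not N _ f).symm
  have hPN : ∀ v ∈ P, v ∈ N := fun v hv => (Finset.mem_filter.1 hv).1
  have htri : ∀ v ∈ P, ∃ w ∈ N, ∃ z ∈ N, G.Adj v w ∧ G.Adj v z ∧ G.Adj w z ∧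
      ∀ y ∈ N, G.Adj v y → y = w ∨ y = z := by
    intro v hv
    obtain ⟨hvN, hv0⟩ := Finset.mem_filter.1 hv
    obtain ⟨w, hw, hvw⟩ := exists_adj_of_degIn_ne_zero hv0
    obtain ⟨z, hz, h1, h2, h3, -, -⟩ := exists_triangle hgf hvN hw hvw (hno v hvN) (hno w hw)
    exact ⟨w, hw, z, hz, hvw, h1, h2, h3⟩
  have hP2 : ∀ v ∈ P, degIn G N v = 2 := by
    intro v hv
    obtain ⟨w, hw, z, hz, hvw, hvz, hwz, h⟩ := htri v hv
    exact degIn_eq_two hw hz hvw hvz hwz.ne h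
  have hZ0 : ∀ v ∈ Z, degIn G N v = 0 := fun v hv => not_not.1 (Finset.mem_filter.1 hv).2
  have hdegP : ∀ v ∈ N, degIn G P v = degIn G N v := by
    intro v hv
    have : degIn G N v = degIn G P v + degIn G Z v := hsplit _
    have hz : degIn G Z v = 0 := by
      refine Finset.sum_eq_zero fun z hz => ?_
      rw [adjMatrix_apply, if_neg]
      intro hvz
      have := one_le_degIn hv hvz.symm
      rw [hZ0 z hz] at this
      norm_num at this
    rw [this, hz, add_zero]
  have hsumP : ∀ f : V → ℝ, ∑ v ∈ N, degIn G P v * f v = 2 * ∑ v ∈ P, f v := by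
    intro f
    rw [hsplit, Finset.mul_sum, Finset.sum_eq_zero (s := Z), add_zero]
    · exact Finset.sum_congr rfl fun v hv => by rw [hdegP v (hPN v hv), hP2 v hv]
    · intro v hv
      rw [hdegP v (Finset.mem_filter.1 hv).1, hZ0 v hv, zero_mul]
  set n : ℝ := (P.card : ℝ) with hn
  set a := ∑ v ∈ Z, x v with ha
  set b := ∑ v ∈ P, (1 - x v) with hb
  set c := ∑ w ∈ Wset G u, degIn G N w * (1 - x w) with hc
  set e := (∑ w ∈ Wset G u, degIn G (Wset G u) w) / 2 with he
  have ha0 : 0 ≤ a := Finset.sum_nonneg fun v _ => hx0 v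
  have hb0 : 0 ≤ b := Finset.sum_nonneg fun v _ => sub_nonneg.2 (hx1 v)
  have hc0 : 0 ≤ c := Finset.sum_nonneg fun w _ =>
    mul_nonneg (degIn_nonneg ..) (sub_nonneg.2 (hx1 w))
  have he0 : 0 ≤ e := div_nonneg (Finset.sum_nonneg fun w _ => degIn_nonneg ..) (by norm_num)
  have hPx : ∑ v ∈ P, x v = n - b := by
    rw [hb, Finset.sum_sub_distrib]; simp [hn]
  have hloss : a + b + c + e ≤ 1 := by
    rw [hsplit] at hL
    have h1 : ∑ v ∈ P, (degIn G N v / 2 - (degIn G N v - 1) * x v) = b :=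
      Finset.sum_congr rfl fun v hv => by rw [hP2 v hv]; ring
    have h2 : ∑ v ∈ Z, (degIn G N v / 2 - (degIn G N v - 1) * x v) = a :=
      Finset.sum_congr rfl fun v hv => by rw [hZ0 v hv]; ring
    linarith
  have hl3 : l = n - b + a := by rw [hlam, hsplit, hPx]
  have hS : l * (n - b) = n + 2 * (n - b) + ∑ w ∈ Wset G u, degIn G P w * x w := by
    rw [← hPx, Finset.mul_sum, Finset.sum_congr rfl fun v _ => eigen_split (u := u) hev v,
      Finset.sum_add_distrib, Finset.sum_add_distrib, sum_degIn_comm, sum_degIn_comm, ← hN, hsumP]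
    rw [Finset.sum_congr rfl fun w (hw : w ∈ P) => by
      rw [adjMatrix_comm, adjMatrix_of_mem_neighborFinset G u (hPN w hw), hxu]]
    simp [hn]
  have hthird : ∀ w ∈ Wset G u, 3 * degIn G P w ≤ n := by
    intro w hw
    have h1 : 3 * degIn G P w = ∑ v ∈ P, (G.adjMatrix ℝ w v +
        ∑ y ∈ N, G.adjMatrix ℝ v y * G.adjMatrix ℝ w y) := by
      rw [Finset.sum_add_distrib, sum_degIn_comm, hsumP, degIn]
      ring
    have h2 : n = ∑ v ∈ P, (1 : ℝ) := by simp [hn]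
    rw [h1, h2]
    refine Finset.sum_le_sum fun v hv => ?_
    obtain ⟨p, hp, q, hq, hvp, hvq, hpq, h⟩ := htri v hv
    have h3 : ∑ y ∈ N, G.adjMatrix ℝ v y * G.adjMatrix ℝ w y =
        G.adjMatrix ℝ w p + G.adjMatrix ℝ w q := by
      rw [← Finset.sum_pair hpq.ne, ← Finset.sum_subset (s₁ := {p, q})]
      · refine Finset.sum_congr rfl fun y hy => ?_
        rcases Finset.mem_insert.1 hy with rfl | hy
        · simp [hvp]
        · rw [Finset.mem_singleton.1 hy]; simp [hvq]
      · intro y hy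
        rcases Finset.mem_insert.1 hy with rfl | hy
        · exact hp
        · rw [Finset.mem_singleton.1 hy]; exact hq
      · intro y hy hy'
        rw [adjMatrix_apply, if_neg, zero_mul]
        intro hvy
        exact hy' (by simpa using h y hy hvy)
    rw [h3]
    exact adjMatrix_triangle_le hgf ((mem_neighborFinset ..).1 (hPN v hv))
      ((mem_neighborFinset ..).1 hp) ((mem_neighborFinset ..).1 hq) hvp hvq hpq hw
  have hle : ∀ (s : Finset V) (w : V), ∑ v ∈ s, G.adjMatrix ℝ w v * x v ≤ degIn G s w :=
    fun s w => Finset.sum_le_sum fun v _ =>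
      mul_le_of_le_one_right (adjMatrix_nonneg ..) (hx1 v)
  have hn3 : (3 : ℝ) ≤ n := by
    have : (2 : ℝ) < P.card := by linarith
    have : 2 < P.card := by exact_mod_cast this
    rw [hn]
    exact_mod_cast this
  have hxw : ∀ w ∈ Wset G u, x w ≤ 2 * (1 - x w) := by
    intro w hw
    have h1 := eigen_split (u := u) hev w
    rw [adjMatrix_comm, adjMatrix_of_mem_Wset G u hw, ← hN, hsplit] at h1
    have h2 := hle P w
    have h3 := hle (Wset G u) w
    have h4 : ∑ v ∈ Z, G.adjMatrix ℝ w v * x v ≤ a := Finset.sum_le_sum fun v _ =>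
      mul_le_of_le_one_left (hx0 v) (by rw [adjMatrix_apply]; split_ifs <;> norm_num)
    have h5 := hthird w hw
    have h6 := degIn_le_half_sum (G := G) hw
    have h7 : l * (3 * x w) ≤ l * 2 := by linarith
    have h8 := le_of_mul_le_mul_left h7 (by linarith)
    linarith
  have hS2 : ∑ w ∈ Wset G u, degIn G P w * x w ≤ 2 * c := by
    rw [hc, Finset.mul_sum]
    refine Finset.sum_le_sum fun w hw => ?_
    have h1 : degIn G P w ≤ degIn G N w :=
      Finset.sum_le_sum_of_subset_of_nonneg (Finset.filter_subset _ _)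
        fun v _ _ => adjMatrix_nonneg ..
    calc degIn G P w * x w ≤ degIn G N w * (2 * (1 - x w)) :=
          mul_le_mul h1 (hxw w hw) (hx0 w) (degIn_nonneg ..)
      _ = _ := by ring
  have hfin : (l - 2) * (n - b) ≤ n + 2 * c := by linarith
  have hcases : P.card = 3 ∨ P.card = 4 ∨ 5 ≤ P.card := by
    have : 3 ≤ P.card := by rw [hn] at hn3; exact_mod_cast hn3
    omega
  rcases hcases with h | h | h
  · have h3 : n = 3 := by rw [hn, h]; norm_num
    rw [h3] at hfin hl3
    nlinarith
  · have h4 : n = 4 := by rw [hn, h]; norm_num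
    rw [h4] at hfin hl3
    nlinarith
  · have h5 : (5 : ℝ) ≤ n := by rw [hn]; exact_mod_cast h
    nlinarith [mul_le_mul (show n - 3 ≤ l - 2 by linarith) (show n - 1 ≤ n - b by linarith)
      (by linarith) (by linarith)]

theorem exists_book_structure (hgf : ¬ ContainsCopy gem G) (hniso : ∀ v, ∃ w, G.Adj v w)
    (hx0 : ∀ v, 0 ≤ x v) (hx1 : ∀ v, x v ≤ 1) (hxu : x u = 1)
    (hev : ∀ v, l * x v = ∑ w, G.adjMatrix ℝ v w * x w)
    (hl : (edgeCount G : ℝ) - 1 ≤ l * l - l) (hl' : 3.7 ≤ l) :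
    ∃ c, G.Adj u c ∧ (∀ v, v ≠ u → v ≠ c → G.Adj u v ∧ G.Adj c v) ∧
      ∀ v w, v ≠ u → v ≠ c → w ≠ u → w ≠ c → ¬ G.Adj v w := by
  obtain ⟨t, htN, ht1⟩ := exists_leaf_of_loss_le_one hgf hx0 hx1 hxu hev hl hl'
  have hL := loss_le_one hxu hev hl
  have hlam := eigen_apply_max hxu hev
  set N := G.neighborFinset u with hN
  have hmem : ∀ v, v ∈ N ↔ G.Adj u v := fun v => mem_neighborFinset ..
  have hA0 := adjMatrix_nonneg G
  obtain ⟨c, hcN, htc⟩ := exists_adj_of_degIn_ne_zero (ne_of_eq_of_ne ht1 one_ne_zero)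
  have hct := htc.symm
  have htri : ∀ {v w}, v ∈ N → w ∈ N → G.Adj v w → degIn G N v ≠ 1 → degIn G N w ≠ 1 →
      degIn G N v = 2 ∧ degIn G N w = 2 := by
    intro v w hv hw hvw h1 h2
    obtain ⟨z, hz, hvz, hwz, hv', hw', -⟩ := exists_triangle hgf hv hw hvw h1 h2
    exact ⟨degIn_eq_two hw hz hvw hvz hwz.ne hv', degIn_eq_two hv hz hvw.symm hwz hvz.ne hw'⟩
  have hleaf : ∀ w ∈ N, G.Adj c w → degIn G N w = 1 := by
    intro w hw hcw
    by_contra hne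
    have hwt : w ≠ t := by rintro rfl; exact hne ht1
    obtain ⟨z, hz, hcz, hwz, h, -, -⟩ := exists_triangle hgf hcN hw hcw
      (fun h => hwt (eq_of_degIn_eq_one h hw htN hcw hct)) hne
    rcases h t htN hct with rfl | rfl
    · exact hwt rfl
    · exact hcw.ne (eq_of_degIn_eq_one ht1 hcN hw hcz.symm hwz.symm)
  set g : V → ℝ := fun v => (1 - 1 / degIn G N v) * x v with hg
  have hg_leaf : ∀ v, degIn G N v = 1 → g v = 0 := fun v hv => by simp [hg, hv]
  have hg_lt : ∀ v, 1 ≤ degIn G N v → g v ≤ 1 - 1 / degIn G N v := by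
    intro v hv
    refine mul_le_of_le_one_right ?_ (hx1 v)
    rw [sub_nonneg, div_le_one (by linarith)]
    exact hv
  have hg_lt_one : ∀ v, 1 ≤ degIn G N v → g v < 1 := by
    intro v hv
    have h1 := hg_lt v hv
    have : 0 < 1 / degIn G N v := by positivity
    linarith
  have hg_two : ∀ v, degIn G N v = 2 → g v = x v / 2 := by
    intro v hv
    simp only [hg, hv]
    ring
  set F : V → V → ℝ := fun v w => G.adjMatrix ℝ v w * (1 - g v - g w) with hF
  have hFsymm : ∀ v w, F v w = F w v := fun v w => by
    simp only [hF, adjMatrix_comm G v w]; ring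
  have hFadj : ∀ v w, G.Adj v w → F v w = 1 - g v - g w := fun v w h => by simp [hF, h]
  have hF0 : ∀ v ∈ N, ∀ w ∈ N, 0 ≤ F v w := by
    intro v hv w hw
    by_cases hvw : G.Adj v w
    · rw [hFadj v w hvw]
      by_cases h1 : degIn G N v = 1
      · have := hg_lt_one w (one_le_degIn hv hvw.symm)
        rw [hg_leaf v h1]; linarith
      by_cases h2 : degIn G N w = 1
      · have := hg_lt_one v (one_le_degIn hw hvw)
        rw [hg_leaf w h2]; linarith
      obtain ⟨h3, h4⟩ := htri hv hw hvw h1 h2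
      rw [hg_two v h3, hg_two w h4]
      linarith [hx1 v, hx1 w]
    · simp [hF, hvw]
  have hrow : 1 ≤ ∑ w ∈ N, F c w := by
    have hc1 := one_le_degIn htN hct
    have h1 : ∑ w ∈ N, F c w = degIn G N c * (1 - g c) := by
      rw [degIn, Finset.sum_mul]
      refine Finset.sum_congr rfl fun w hw => ?_
      by_cases hcw : G.Adj c w
      · rw [hFadj c w hcw, hg_leaf w (hleaf w hw hcw)]; simp [hcw]
      · simp [hF, hcw]
    have h2 := hg_lt c hc1
    have h3 : degIn G N c * (1 / degIn G N c) = 1 := by field_simp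
    rw [h1, ← h3]
    exact mul_le_mul_of_nonneg_left (by linarith) (by linarith)
  have hFsum : ∑ v ∈ N, ∑ w ∈ N, F v w =
      ∑ v ∈ N, (degIn G N v - 2 * (degIn G N v * g v)) := by
    have h1 : ∀ v w, F v w =
        G.adjMatrix ℝ v w - G.adjMatrix ℝ v w * g v - G.adjMatrix ℝ v w * g w :=
      fun v w => by simp only [hF]; ring
    simp only [h1, Finset.sum_sub_distrib]
    rw [sum_degIn_comm]
    simp only [← Finset.sum_mul, ← Finset.mul_sum, degIn]
    ring
  have hloss : ∑ v ∈ N, (degIn G N v / 2 - (degIn G N v - 1) * x v) =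
      ∑ v ∈ N, (if degIn G N v = 0 then x v else 0) + (∑ v ∈ N, ∑ w ∈ N, F v w) / 2 := by
    rw [hFsum, Finset.sum_div, ← Finset.sum_add_distrib]
    refine Finset.sum_congr rfl fun v _ => ?_
    split_ifs with h
    · rw [h]; ring
    · simp only [hg]
      field_simp
      ring
  rw [hloss, sum_sum_eq_of_symm hcN hFsymm (by simp [hF])] at hL
  have hE0 : ∀ w ∈ Wset G u, 0 ≤ degIn G (Wset G u) w := fun w _ => degIn_nonneg ..
  have hC0 : ∀ w ∈ Wset G u, 0 ≤ degIn G N w * (1 - x w) := fun w _ =>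
    mul_nonneg (degIn_nonneg ..) (sub_nonneg.2 (hx1 w))
  have hZ0 : ∀ v ∈ N, 0 ≤ (if degIn G N v = 0 then x v else 0) := fun v _ => by
    split_ifs
    exacts [hx0 v, le_rfl]
  have hR0 : ∀ v ∈ N.erase c, 0 ≤ ∑ w ∈ N.erase c, F v w := fun v hv =>
    Finset.sum_nonneg fun w hw => hF0 v (Finset.mem_of_mem_erase hv) w (Finset.mem_of_mem_erase hw)
  have hE := Finset.sum_nonneg hE0
  have hC := Finset.sum_nonneg hC0
  have hZ := Finset.sum_nonneg hZ0
  have hR := Finset.sum_nonneg hR0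
  have hE' := (Finset.sum_eq_zero_iff_of_nonneg hE0).1 (by linarith)
  have hC' := (Finset.sum_eq_zero_iff_of_nonneg hC0).1 (by linarith)
  have hZ' := (Finset.sum_eq_zero_iff_of_nonneg hZ0).1 (by linarith)
  have hR' := (Finset.sum_eq_zero_iff_of_nonneg hR0).1 (by linarith)
  clear hE0 hC0 hZ0 hR0 hE hC hZ hR hL hloss hFsum hrow
  have hFz : ∀ v ∈ N, ∀ w ∈ N, v ≠ c → w ≠ c → F v w = 0 := by
    intro v hv w hw hvc hwc
    refine (Finset.sum_eq_zero_iff_of_nonneg fun w hw => ?_).1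
      (hR' v (Finset.mem_erase.2 ⟨hvc, hv⟩)) w (Finset.mem_erase.2 ⟨hwc, hw⟩)
    exact hF0 v hv w (Finset.mem_of_mem_erase hw)
  have hlx : ∀ v ∈ N, 1 ≤ l * x v := by
    intro v hv
    rw [hev]
    have := Finset.single_le_sum (f := fun w => G.adjMatrix ℝ v w * x w)
      (fun w _ => mul_nonneg (hA0 v w) (hx0 w)) (Finset.mem_univ u)
    simpa [hxu, ((hmem v).1 hv).symm] using this
  have hxpos : ∀ v ∈ N, 0 < x v := by
    intro v hv
    by_contra h
    have := hlx v hv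
    nlinarith [hx0 v]
  have hnbr : ∀ v ∈ N, ∃ w ∈ N, G.Adj v w := by
    intro v hv
    refine exists_adj_of_degIn_ne_zero fun h => ?_
    have := hZ' v hv
    rw [if_pos h] at this
    exact (hxpos v hv).ne' this
  have hnotleaf : ∀ v ∈ N, ∀ w ∈ N, v ≠ c → w ≠ c → G.Adj v w → degIn G N v ≠ 1 := by
    intro v hv w hw hvc hwc hvw h1
    have h2 := hFz v hv w hw hvc hwc
    rw [hFadj v w hvw, hg_leaf v h1] at h2
    have := hg_lt_one w (one_le_degIn hv hvw.symm)
    linarith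
  have hW : Wset G u = ∅ := by
    by_contra hne
    obtain ⟨w, hw⟩ := Finset.nonempty_iff_ne_empty.2 hne
    obtain ⟨hwu, huw⟩ := not_adj_of_mem_Wset hw
    have hdW : ∀ y ∈ Wset G u, ¬ G.Adj w y := by
      intro y hy hwy
      have := one_le_degIn hy hwy
      rw [hE' w hw] at this
      norm_num at this
    obtain ⟨y, hwy⟩ := hniso w
    have hyN : y ∈ N := by
      rw [hmem]
      by_contra h
      refine hdW y ?_ hwy
      have hyu : y ≠ u := by rintro rfl; exact huw hwy.symm
      simp [Wset, h, hyu]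
    have hxw : x w = 1 := by
      have h1 := one_le_degIn hyN hwy
      rcases mul_eq_zero.1 (hC' w hw) with h | h <;> linarith
    have hall : ∀ v ∈ N, G.Adj w v := by
      have h1 := eigen_split (u := u) hev w
      rw [hxw, adjMatrix_comm, adjMatrix_of_mem_Wset G u hw, ← hN, Finset.sum_eq_zero
        (s := Wset G u) fun y hy => by rw [adjMatrix_apply, if_neg (hdW y hy), zero_mul]] at h1
      have h2 : ∀ v ∈ N, 0 ≤ (1 - G.adjMatrix ℝ w v) * x v := fun v _ =>
        mul_nonneg (by rw [adjMatrix_apply]; split_ifs <;> norm_num) (hx0 v)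
      have h3 := (Finset.sum_eq_zero_iff_of_nonneg h2).1 (by
        simp only [sub_mul, one_mul, Finset.sum_sub_distrib]
        linarith)
      intro v hv
      by_contra h
      have := h3 v hv
      simp only [adjMatrix_apply, if_neg h, sub_zero, one_mul] at this
      exact (hxpos v hv).ne' this
    have hone : ∀ v ∈ N, degIn G N v = 1 := by
      intro v hv
      obtain ⟨p, hp, hvp⟩ := hnbr v hv
      by_contra h
      obtain ⟨q, hq, hvq, hqp⟩ := exists_adj_ne_of_degIn_ne_one hp hvp h
      refine gem_free_no_hub_path hgf hvp ((hmem v).1 hv).symm hvq (hall v hv).symm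
        ((hmem p).1 hp).symm ((hmem q).1 hq) (hall q hq).symm hqp.symm ?_ hwu.symm
      rintro rfl
      exact huw ((hmem p).1 hp)
    have hbig : ∃ v ∈ N, v ≠ c ∧ v ≠ t := by
      by_contra! hcon
      have hsub : N ⊆ {c, t} := by
        intro v hv
        simp only [Finset.mem_insert, Finset.mem_singleton]
        by_contra! h
        exact h.2 (hcon v hv h.1)
      have h1 : ∑ v ∈ N, x v ≤ ∑ v ∈ ({c, t} : Finset V), x v :=
        Finset.sum_le_sum_of_subset_of_nonneg hsub fun v _ _ => hx0 v
      rw [Finset.sum_pair hct.ne] at h1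
      linarith [hx1 c, hx1 t]
    obtain ⟨v, hv, hvc, hvt⟩ := hbig
    obtain ⟨p, hp, hvp⟩ := hnbr v hv
    have hpc : p ≠ c := by
      rintro rfl
      exact hvt (eq_of_degIn_eq_one (hone p hp) hv htN hvp.symm hct)
    exact hnotleaf v hv p hp hvc hpc hvp (hone v hv)
  have hVN : ∀ v, v ≠ u → v ∈ N := by
    intro v hv
    rw [hmem]
    by_contra h
    have : v ∈ Wset G u := by simp [Wset, hv, h]
    simp [hW] at this
  have hnone : ∀ v ∈ N, ∀ w ∈ N, v ≠ c → w ≠ c → ¬ G.Adj v w := by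
    intro v hv w hw hvc hwc hvw
    have h1 := hnotleaf v hv w hw hvc hwc hvw
    have h2 := hnotleaf w hw v hv hwc hvc hvw.symm
    obtain ⟨h3, h4⟩ := htri hv hw hvw h1 h2
    have h5 := hFz v hv w hw hvc hwc
    rw [hFadj v w hvw, hg_two v h3, hg_two w h4] at h5
    have hxv : x v = 1 := by linarith [hx1 v, hx1 w]
    have h6 := eigen_split (u := u) hev v
    rw [hxv, hxu, adjMatrix_comm, adjMatrix_of_mem_neighborFinset G u hv, hW, ← hN,
      Finset.sum_empty] at h6
    have h7 : ∑ y ∈ N, G.adjMatrix ℝ v y * x y ≤ degIn G N v :=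
      Finset.sum_le_sum fun y _ => mul_le_of_le_one_right (hA0 v y) (hx1 y)
    linarith
  refine ⟨c, (hmem c).1 hcN, fun v hvu hvc => ⟨(hmem v).1 (hVN v hvu), ?_⟩,
    fun v w hvu hvc hwu hwc => hnone v (hVN v hvu) w (hVN w hwu) hvc hwc⟩
  obtain ⟨w, hw, hvw⟩ := hnbr v (hVN v hvu)
  by_contra hcv
  refine hnone v (hVN v hvu) w hw hvc ?_ hvw
  rintro rfl
  exact hcv hvw.symm

end Extremal

theorem edgeCount_bookS (k : ℕ) : edgeCount (bookS k) = 2 * k + 1 := by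
  have h := two_mul_edgeCount_eq_sum (bookS k)
  simp only [Fintype.sum_sum_type, Fin.sum_univ_two, adjMatrix_apply] at h
  simp [bookS] at h
  have : (edgeCount (bookS k) : ℝ) = ((2 * k + 1 : ℕ) : ℝ) := by
    push_cast
    rw [bookS]
    linarith
  exact_mod_cast this

theorem nonempty_iso_bookS {V : Type*} [Fintype V] {G : SimpleGraph V} {u c : V}
    (huc : G.Adj u c) (h : ∀ v, v ≠ u → v ≠ c → G.Adj u v ∧ G.Adj c v)
    (h' : ∀ v w, v ≠ u → v ≠ c → w ≠ u → w ≠ c → ¬ G.Adj v w) :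
    ∃ k, Nonempty (G ≃g bookS k) := by
  let T := {v : V // v ≠ u ∧ v ≠ c}
  let φ := (Fintype.equivFin T).symm
  refine ⟨Fintype.card T, ⟨RelIso.symm ⟨Equiv.ofBijective
    (Sum.elim ![u, c] fun i => (φ i : V)) ⟨?_, ?_⟩, ?_⟩⟩⟩
  · have hu : ∀ i, u ≠ φ i := fun i => (φ i).2.1.symm
    have hc : ∀ i, c ≠ φ i := fun i => (φ i).2.2.symm
    rintro (a | a) (b | b) hab
    · fin_cases a <;> fin_cases b <;> simp_all [huc.ne, huc.ne']
    · fin_cases a <;> simp_all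
    · fin_cases b <;> simp_all [eq_comm]
    · exact congrArg Sum.inr (φ.injective (Subtype.ext hab))
  · intro v
    by_cases hu : v = u
    · exact ⟨Sum.inl 0, by simp [hu]⟩
    by_cases hc : v = c
    · exact ⟨Sum.inl 1, by simp [hc]⟩
    exact ⟨Sum.inr (φ.symm ⟨v, hu, hc⟩), by simp⟩
  · have hu : ∀ i, G.Adj u (φ i) := fun i => (h _ (φ i).2.1 (φ i).2.2).1
    have hc : ∀ i, G.Adj c (φ i) := fun i => (h _ (φ i).2.1 (φ i).2.2).2
    intro a b
    change G.Adj (Sum.elim ![u, c] (fun i => (φ i : V)) a)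
      (Sum.elim ![u, c] (fun i => (φ i : V)) b) ↔ _
    rcases a with a | a <;> rcases b with b | b
    · fin_cases a <;> fin_cases b <;> simp [bookS, huc, huc.symm]
    · fin_cases a <;> simp [bookS, hu, hc]
    · fin_cases b <;> simp [bookS, (hu _).symm, (hc _).symm]
    · simpa [bookS] using h' _ _ (φ a).2.1 (φ a).2.2 (φ b).2.1 (φ b).2.2

theorem nonempty_iso_of_le_specRad {V : Type*} [Fintype V] (G : SimpleGraph V) {k : ℕ}
    (hk : 5 ≤ k) (hgf : ¬ ContainsCopy gem G) (hcard : edgeCount G = 2 * k + 1)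
    (hniso : ∀ v : V, ∃ w, G.Adj v w) (hl : (1 + √(1 + 8 * k)) / 2 ≤ specRad G) :
    Nonempty (G ≃g bookS k) := by
  have hne : Nonempty V := by
    by_contra hV
    rw [not_nonempty_iff] at hV
    have : G.edgeFinset.card = 0 := by
      rw [Finset.card_eq_zero, Finset.eq_empty_iff_forall_notMem]
      intro e
      exact e.ind fun a => isEmptyElim a
    rw [edgeCount] at hcard
    omega
  obtain ⟨x, u, hx0, hx1, hxu, hev⟩ := exists_nonneg_eigenvector G
  have hk' : (5 : ℝ) ≤ k := by exact_mod_cast hk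
  have hsq : √(1 + 8 * (k : ℝ)) ^ 2 = 1 + 8 * k := Real.sq_sqrt (by positivity)
  have hs0 : 6.4 ≤ √(1 + 8 * (k : ℝ)) := Real.le_sqrt_of_sq_le (by norm_num; linarith)
  have h1 : (edgeCount G : ℝ) - 1 ≤ specRad G * specRad G - specRad G := by
    rw [hcard]
    push_cast
    nlinarith
  obtain ⟨c, huc, h2, h3⟩ :=
    exists_book_structure hgf hniso hx0 hx1 hxu hev h1 (by linarith)
  obtain ⟨j, ⟨e⟩⟩ := nonempty_iso_bookS huc h2 h3
  have h4 : edgeCount G = edgeCount (bookS j) := e.card_edgeFinset_eq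
  rw [hcard, edgeCount_bookS] at h4
  obtain rfl : k = j := by omega
  exact ⟨e⟩

theorem stmt16 {V : Type*} [Fintype V] (G : SimpleGraph V) (m : ℕ)
    (hodd : Odd m) (hm : 11 ≤ m)
    (hgf : ¬ ContainsCopy gem G) (hcard : edgeCount G = m)
    (hniso : ∀ v : V, ∃ w, G.Adj v w) :
    specRad G ≤ specRad (bookS ((m - 1) / 2)) ∧
      (specRad G = specRad (bookS ((m - 1) / 2)) ↔
        Nonempty (G ≃g bookS ((m - 1) / 2))) := by
  obtain ⟨k, rfl⟩ := hodd
  rw [show (2 * k + 1 - 1) / 2 = k by omega]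
  have hk : 5 ≤ k := by omega
  have hbook := le_specRad_bookS k
  refine ⟨?_, fun h => ?_, fun ⟨e⟩ => specRad_eq_of_iso e⟩
  · by_contra! h
    obtain ⟨e⟩ := nonempty_iso_of_le_specRad G hk hgf hcard hniso (by linarith)
    exact h.ne' (specRad_eq_of_iso e)
  · exact nonempty_iso_of_le_specRad G hk hgf hcard hniso (by linarith)
end
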